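/- Let k ≥ 2, p ∈ [2,∞], and let ℓ̃ : ℝ^{k−1} → ℝ be nonnegative, convex, differentiable and β-smooth with respect to the L_p norm; let ℓ(ŷ, y) = ℓ̃(D_y ŷ). Let S = ((x_1,y_1),…,(x_n,y_n)) with ‖x_i‖₂ ≤ 1 for all i, and let W_1 = 0, W_{t+1} = W_t − η ∇L̂(W_t) be gradient descent on the empirical risk L̂ with step size η ≤ 1/(6 β k^{2/p}). Fix ε > 0 and any W*_ε ∈ ℝ^{k×d} with L̂(W*_ε) ≤ ε. Then for every T ≥ 1, L̂(W_T) ≤ ‖W*_ε‖_F² / (η T) + 2ε. -/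

import Mathlib

open Real Filter MeasureTheory Finset
open scoped ENNReal

/-- The `L_p` norm of a vector in `ℝ^m`, for `p ∈ [1,∞]` (as an `ℝ≥0∞` parameter). -/
noncomputable def pnorm (p : ℝ≥0∞) {m : ℕ} (v : Fin m → ℝ) : ℝ :=
  ‖(WithLp.equiv p (Fin m → ℝ)).symm v‖

/-- The gradient of `f : ℝ^m → ℝ`, as the vector of partial derivatives. -/
noncomputable def grad {m : ℕ} (f : (Fin m → ℝ) → ℝ) (w : Fin m → ℝ) : Fin m → ℝ :=
  fun i => fderiv ℝ f w (Pi.single i 1)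

/-- The Frobenius norm of a `k × d` matrix. -/
noncomputable def frob {k d : ℕ} (A : Fin k → Fin d → ℝ) : ℝ :=
  Real.sqrt (∑ i, ∑ j, A i j ^ 2)

/-- The gradient of a function of a `k × d` matrix, as the matrix of partial derivatives. -/
noncomputable def gradM {k d : ℕ} (f : (Fin k → Fin d → ℝ) → ℝ) (W : Fin k → Fin d → ℝ) :
    Fin k → Fin d → ℝ :=
  fun i j => fderiv ℝ f W (Pi.single i (Pi.single j 1))

/-- The increasing enumeration of `{0, …, k-1} \ {y}` by `Fin (k-1)`. -/
def skipIdx {k : ℕ} (y : Fin k) (j : Fin (k - 1)) : Fin k :=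
  if (j : ℕ) < (y : ℕ) then ⟨j, by have := j.isLt; omega⟩
  else ⟨(j : ℕ) + 1, by have := j.isLt; omega⟩

/-- The linear map `D_y : ℝ^k → ℝ^{k-1}` sending `v` to the vector `(v_y - v_j)_{j ≠ y}`. -/
def Dmap {k : ℕ} (y : Fin k) (v : Fin k → ℝ) : Fin (k - 1) → ℝ :=
  fun j => v y - v (skipIdx y j)

lemma aux_p_real {p : ℝ≥0∞} (hp : 1 ≤ p) (ht : p ≠ ⊤) : 1 ≤ p.toReal := by
  have := ENNReal.toReal_mono ht hp
  simpa using this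

lemma pnorm_top {m : ℕ} (v : Fin m → ℝ) : pnorm ⊤ v = ‖v‖ := by
  simp [pnorm]

lemma pnorm_real {p : ℝ≥0∞} (hp : 1 ≤ p) (ht : p ≠ ⊤) {m : ℕ} (v : Fin m → ℝ) :
    pnorm p v = (∑ i, |v i| ^ p.toReal) ^ (1 / p.toReal) := by
  have h := aux_p_real hp ht
  unfold pnorm
  rw [PiLp.norm_eq_sum (by linarith)]
  simp

lemma pnorm_one {m : ℕ} (v : Fin m → ℝ) : pnorm 1 v = ∑ i, |v i| := by
  rw [pnorm_real le_rfl (by simp)]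
  simp

lemma pnorm_smul' {p : ℝ≥0∞} (hp : 1 ≤ p) {m : ℕ} (s : ℝ) (v : Fin m → ℝ) :
    pnorm p (s • v) = |s| * pnorm p v := by
  haveI : Fact (1 ≤ p) := ⟨hp⟩
  have : (WithLp.equiv p (Fin m → ℝ)).symm (s • v) = s • (WithLp.equiv p (Fin m → ℝ)).symm v := rfl
  unfold pnorm
  rw [this, norm_smul, Real.norm_eq_abs]

lemma holder_pnorm {p q : ℝ≥0∞} (hp : 2 ≤ p) (hpq : 1 / p + 1 / q = 1) {m : ℕ}
    (g h : Fin m → ℝ) : ∑ i, g i * h i ≤ pnorm q g * pnorm p h := by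
  have hp1 : 1 ≤ p := le_trans (by norm_num) hp
  by_cases ht : p = ⊤
  · subst ht
    have hq : q = 1 := by
      simpa using hpq
    subst hq
    rw [pnorm_top, pnorm_one, Finset.sum_mul]
    refine Finset.sum_le_sum fun i _ => ?_
    calc g i * h i ≤ |g i * h i| := le_abs_self _
      _ = |g i| * |h i| := abs_mul _ _
      _ ≤ |g i| * ‖h‖ := by
        gcongr
        exact norm_le_pi_norm h i
  · have h2 : 2 ≤ p.toReal := by
      have := ENNReal.toReal_mono ht hp
      simpa using this
    have hc : p.HolderConjugate q := by
      rw [ENNReal.holderConjugate_iff]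
      simpa using hpq
    have hq1 : 1 ≤ q := by
      haveI := hc
      exact ENNReal.HolderConjugate.one_le q p
    have hqt : q ≠ ⊤ := by
      rintro rfl
      have : p⁻¹ = 1 := by simpa using hpq
      have : p = 1 := by simpa using this
      rw [this] at h2
      norm_num at h2
    have hr : Real.HolderConjugate q.toReal p.toReal := by
      rw [Real.holderConjugate_iff]
      have e : q.toReal⁻¹ + p.toReal⁻¹ = 1 := by
        have := congrArg ENNReal.toReal hpq
        rw [ENNReal.toReal_add] at this
        · simp at this
          linarith
        · simp
          rintro rfl
          simp at h2
          linarith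
        · simp
          rintro rfl
          simp at hq1
      refine ⟨?_, e⟩
      have : p.toReal⁻¹ > 0 := by positivity
      have h1 := aux_p_real hq1 hqt
      rcases h1.lt_or_eq with h | h
      · exact h
      · rw [← h] at e
        simp at e
        rw [e] at h2
        linarith
    rw [pnorm_real hp1 ht, pnorm_real hq1 hqt]
    exact Real.inner_le_Lp_mul_Lq _ _ _ hr

lemma pnorm_sq_le {p : ℝ≥0∞} (hp : 2 ≤ p) {k : ℕ} (hk : 2 ≤ k) (u : Fin (k - 1) → ℝ) (c : ℝ)
    (hc : 0 ≤ c) (h : ∀ i, u i ^ 2 ≤ c) : pnorm p u ^ 2 ≤ (k : ℝ) ^ (2 / p.toReal) * c := by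
  have hp1 : 1 ≤ p := le_trans (by norm_num) hp
  have habs : ∀ i, |u i| ≤ √c := fun i => Real.abs_le_sqrt (h i)
  by_cases ht : p = ⊤
  · subst ht
    rw [pnorm_top]
    simp only [ENNReal.toReal_top, div_zero, Real.rpow_zero, one_mul]
    have : ‖u‖ ≤ √c := (pi_norm_le_iff_of_nonneg (Real.sqrt_nonneg _)).2 habs
    calc ‖u‖ ^ 2 ≤ √c ^ 2 := by gcongr
      _ = c := Real.sq_sqrt hc
  · have h1 := aux_p_real hp1 ht
    rw [pnorm_real hp1 ht]
    set r := p.toReal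
    have hr : 0 < r := by linarith
    have hs : ∑ i, |u i| ^ r ≤ k * √c ^ r := by
      calc ∑ i, |u i| ^ r ≤ ∑ i : Fin (k - 1), √c ^ r :=
            Finset.sum_le_sum fun i _ => Real.rpow_le_rpow (abs_nonneg _) (habs i) hr.le
        _ = ((k - 1 : ℕ) : ℝ) * √c ^ r := by simp
        _ ≤ _ := by
          gcongr
          omega
    have hs0 : 0 ≤ ∑ i, |u i| ^ r := Finset.sum_nonneg fun i _ => by positivity
    have : (∑ i, |u i| ^ r) ^ (1 / r) ≤ (k : ℝ) ^ (1 / r) * √c := by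
      calc _ ≤ (k * √c ^ r) ^ (1 / r) := Real.rpow_le_rpow hs0 hs (by positivity)
        _ = _ := by
          rw [Real.mul_rpow (by positivity) (by positivity), ← Real.rpow_mul (by positivity)]
          rw [mul_one_div_cancel hr.ne', Real.rpow_one]
    calc _ ≤ ((k : ℝ) ^ (1 / r) * √c) ^ 2 := by gcongr
      _ = ((k : ℝ) ^ (1 / r)) ^ 2 * c := by rw [mul_pow, Real.sq_sqrt hc]
      _ = _ := by
        rw [← Real.rpow_natCast, ← Real.rpow_mul (by positivity)]
        congr 2
        push_cast
        ring

lemma fderiv_eq_grad {m : ℕ} (f : (Fin m → ℝ) → ℝ) (u h : Fin m → ℝ) :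
    fderiv ℝ f u h = ∑ i, grad f u i * h i := by
  conv_lhs => rw [← Finset.univ_sum_single h]
  rw [map_sum]
  refine Finset.sum_congr rfl fun i _ => ?_
  have : (Pi.single i (h i) : Fin m → ℝ) = h i • Pi.single i 1 := by
    rw [← Pi.single_smul]; simp
  rw [this, map_smul]
  simp [grad, mul_comm]

lemma fderiv_eq_gradM {k d : ℕ} (f : (Fin k → Fin d → ℝ) → ℝ) (W V : Fin k → Fin d → ℝ) :
    fderiv ℝ f W V = ∑ i, ∑ j, gradM f W i j * V i j := by
  conv_lhs => rw [← Finset.univ_sum_single V]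
  rw [map_sum]
  refine Finset.sum_congr rfl fun i _ => ?_
  have : (Pi.single i (V i) : Fin k → Fin d → ℝ)
      = ∑ j, V i j • Pi.single i (Pi.single j 1) := by
    ext a b
    simp only [Finset.sum_apply, Pi.smul_apply, Pi.single_apply]
    by_cases hab : a = i
    · subst hab
      simp [Pi.single_apply]
    · simp [hab]
  rw [this, map_sum]
  refine Finset.sum_congr rfl fun j _ => ?_
  rw [map_smul]
  simp [gradM, mul_comm]

lemma hasDerivAt_line {E : Type*} [NormedAddCommGroup E] [NormedSpace ℝ E] {f : E → ℝ}
    (hf : Differentiable ℝ f) (u h : E) (s : ℝ) :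
    HasDerivAt (fun s : ℝ => f (u + s • h)) (fderiv ℝ f (u + s • h) h) s := by
  have h1 : HasDerivAt (fun s : ℝ => u + s • h) h s := by
    simpa using ((hasDerivAt_id s).smul_const h).const_add u
  exact (hf (u + s • h)).hasFDerivAt.comp_hasDerivAt s h1

lemma convex_first_order {E : Type*} [NormedAddCommGroup E] [NormedSpace ℝ E] {f : E → ℝ}
    (hf : Differentiable ℝ f) (hc : ConvexOn ℝ Set.univ f) (u h : E) :
    f u + fderiv ℝ f u h ≤ f (u + h) := by
  have hd := hasDerivAt_line hf u h 0
  have hcl : ConvexOn ℝ Set.univ (fun s : ℝ => f (u + s • h)) := by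
    refine ⟨convex_univ, fun a _ b _ α β hα hβ hαβ => ?_⟩
    have := hc.2 (Set.mem_univ (u + a • h)) (Set.mem_univ (u + b • h)) hα hβ hαβ
    refine le_trans (le_of_eq ?_) this
    refine congrArg f ?_
    obtain rfl : β = 1 - α := by linarith
    simp only [smul_eq_mul]
    module
  have := hcl.le_slope_of_hasDerivAt (Set.mem_univ 0) (Set.mem_univ 1) one_pos hd
  simp [slope_def_field] at this
  linarith

lemma descent_ltil {m : ℕ} {p q : ℝ≥0∞} (hp : 2 ≤ p) (hpq : 1 / p + 1 / q = 1) {β : ℝ}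
    {f : (Fin m → ℝ) → ℝ} (hf : Differentiable ℝ f)
    (hs : ∀ u v, pnorm q (grad f u - grad f v) ≤ β * pnorm p (u - v)) (u h : Fin m → ℝ) :
    f (u + h) ≤ f u + fderiv ℝ f u h + β / 2 * pnorm p h ^ 2 := by
  have hp1 : 1 ≤ p := le_trans (by norm_num) hp
  set c := fderiv ℝ f u h
  set N := pnorm p h
  have hN : 0 ≤ N := by
    haveI : Fact (1 ≤ p) := ⟨hp1⟩
    exact norm_nonneg _
  let ψ : ℝ → ℝ := fun s => f (u + s • h) - s * c - β / 2 * s ^ 2 * N ^ 2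
  have hψ : ∀ s, HasDerivAt ψ (fderiv ℝ f (u + s • h) h - c - β * s * N ^ 2) s := by
    intro s
    have h1 := ((hasDerivAt_line hf u h s).sub ((hasDerivAt_id s).mul_const c)).sub
      ((((hasDerivAt_id s).pow 2).const_mul (β / 2)).mul_const (N ^ 2))
    refine h1.congr_deriv ?_
    simp only [id]
    push_cast
    ring
  have hanti : AntitoneOn ψ (Set.Icc 0 1) := by
    apply antitoneOn_of_deriv_nonpos (convex_Icc 0 1)
    · exact fun s _ => (hψ s).continuousAt.continuousWithinAt
    · exact fun s _ => (hψ s).differentiableAt.differentiableWithinAt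
    · intro s hsI
      rw [interior_Icc] at hsI
      rw [(hψ s).deriv]
      have e : fderiv ℝ f (u + s • h) h - c
          = ∑ i, (grad f (u + s • h) - grad f u) i * h i := by
        simp only [c, fderiv_eq_grad, Pi.sub_apply, sub_mul, Finset.sum_sub_distrib]
      have h2 := holder_pnorm hp hpq (grad f (u + s • h) - grad f u) h
      have h3 := hs (u + s • h) u
      rw [add_sub_cancel_left, pnorm_smul' hp1, abs_of_pos hsI.1] at h3
      have h4 := mul_le_mul_of_nonneg_right h3 hN
      rw [e]
      have : β * (s * N) * N = β * s * N ^ 2 := by ring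
      change _ ≤ β * (s * N) * N at h4
      linarith
  have := hanti (Set.left_mem_Icc.2 zero_le_one) (Set.right_mem_Icc.2 zero_le_one) zero_le_one
  simp [ψ] at this
  linarith

lemma Dmap_sq_le {k : ℕ} (y : Fin k) (v : Fin k → ℝ) (j : Fin (k - 1)) :
    Dmap y v j ^ 2 ≤ 2 * ∑ r, v r ^ 2 := by
  have hne : y ≠ skipIdx y j := by
    intro h
    have := congrArg Fin.val h
    unfold skipIdx at this
    split_ifs at this <;> simp at this <;> omega
  have h1 : ∑ r ∈ {y, skipIdx y j}, v r ^ 2 ≤ ∑ r, v r ^ 2 :=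
    Finset.sum_le_sum_of_subset_of_nonneg (Finset.subset_univ _) fun _ _ _ => sq_nonneg _
  rw [Finset.sum_pair hne] at h1
  unfold Dmap
  nlinarith [sq_nonneg (v y + v (skipIdx y j))]

lemma matvec_sq_le {k d : ℕ} (V : Fin k → Fin d → ℝ) (x : Fin d → ℝ) (hx : pnorm 2 x ≤ 1) :
    ∑ r, (∑ t, V r t * x t) ^ 2 ≤ ∑ r, ∑ t, V r t ^ 2 := by
  have hx2 : ∑ t, x t ^ 2 ≤ 1 := by
    have h0 : 0 ≤ pnorm 2 x := norm_nonneg _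
    have : pnorm 2 x ^ 2 = ∑ t, x t ^ 2 := by
      unfold pnorm
      rw [EuclideanSpace.norm_sq_eq]
      simp
    rw [← this]
    nlinarith
  refine Finset.sum_le_sum fun r _ => ?_
  refine (Finset.sum_mul_sq_le_sq_mul_sq _ _ _).trans ?_
  have : 0 ≤ ∑ t, V r t ^ 2 := Finset.sum_nonneg fun _ _ => sq_nonneg _
  nlinarith

/-- The linear map `W ↦ D_y (W x)`. -/
noncomputable def Amap {k d : ℕ} (y : Fin k) (x : Fin d → ℝ) :
    (Fin k → Fin d → ℝ) →L[ℝ] (Fin (k - 1) → ℝ) :=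
  LinearMap.toContinuousLinearMap
    { toFun := fun W => Dmap y (fun r => ∑ t, W r t * x t)
      map_add' := by
        intro W V
        ext j
        simp [Dmap, add_mul, Finset.sum_add_distrib]
        ring
      map_smul' := by
        intro c W
        ext j
        simp [Dmap, mul_assoc, ← Finset.mul_sum]
        ring }

lemma gd_abstract {k d : ℕ} (L : (Fin k → Fin d → ℝ) → ℝ) (M : ℝ) (hM : 0 < M)
    (h0 : ∀ W, 0 ≤ L W)
    (hc : ∀ W V, L W + fderiv ℝ L W V ≤ L (W + V))
    (hd : ∀ W V, L (W + V) ≤ L W + fderiv ℝ L W V + M / 2 * ∑ i, ∑ j, V i j ^ 2)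
    (η : ℝ) (hη0 : 0 < η) (hη : η * M ≤ 1 / 3)
    (W : ℕ → Fin k → Fin d → ℝ) (hW1 : W 1 = 0)
    (hWrec : ∀ t, 1 ≤ t → W (t + 1) = W t - η • gradM L (W t))
    (ε : ℝ) (hε : 0 < ε) (Wε : Fin k → Fin d → ℝ) (hWε : L Wε ≤ ε) :
    ∀ T : ℕ, 1 ≤ T → L (W T) ≤ frob Wε ^ 2 / (η * T) + 2 * ε := by
  have step : ∀ U s, L (U - s • gradM L U)
      ≤ L U - (s - M / 2 * s ^ 2) * ∑ i, ∑ j, gradM L U i j ^ 2 := by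
    intro U s
    have := hd U (-(s • gradM L U))
    rw [← sub_eq_add_neg, fderiv_eq_gradM] at this
    refine this.trans (le_of_eq ?_)
    have e1 : ∑ i, ∑ j, gradM L U i j * (-(s • gradM L U)) i j
        = -s * ∑ i, ∑ j, gradM L U i j ^ 2 := by
      simp only [Finset.mul_sum]
      refine Finset.sum_congr rfl fun i _ => Finset.sum_congr rfl fun j _ => ?_
      simp
      ring
    have e2 : ∑ i, ∑ j, (-(s • gradM L U)) i j ^ 2
        = s ^ 2 * ∑ i, ∑ j, gradM L U i j ^ 2 := by
      simp only [Finset.mul_sum]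
      refine Finset.sum_congr rfl fun i _ => Finset.sum_congr rfl fun j _ => ?_
      simp
      ring
    rw [e1, e2]
    ring
  have hG0 : ∀ U, 0 ≤ ∑ i, ∑ j, gradM L U i j ^ 2 := fun U =>
    Finset.sum_nonneg fun _ _ => Finset.sum_nonneg fun _ _ => sq_nonneg _
  have self : ∀ U, ∑ i, ∑ j, gradM L U i j ^ 2 ≤ 2 * M * L U := by
    intro U
    have h1 := step U (1 / M)
    have h2 := h0 (U - (1 / M) • gradM L U)
    have e : 1 / M - M / 2 * (1 / M) ^ 2 = 1 / (2 * M) := by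
      field_simp
      ring
    rw [e] at h1
    have h3 : 1 / (2 * M) * ∑ i, ∑ j, gradM L U i j ^ 2 ≤ L U := by linarith
    rw [one_div, inv_mul_le_iff₀ (by positivity)] at h3
    exact h3
  have mono : ∀ t, 1 ≤ t → L (W (t + 1)) ≤ L (W t) := by
    intro t ht
    rw [hWrec t ht]
    have := step (W t) η
    have h1 : 0 ≤ η - M / 2 * η ^ 2 := by nlinarith
    nlinarith [mul_nonneg h1 (hG0 (W t))]
  let R : ℕ → ℝ := fun t => ∑ i, ∑ j, (W t i j - Wε i j) ^ 2
  have hR0 : ∀ t, 0 ≤ R t := fun t =>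
    Finset.sum_nonneg fun _ _ => Finset.sum_nonneg fun _ _ => sq_nonneg _
  have hR : ∀ t, 1 ≤ t → R (t + 1) ≤ R t - 4 / 3 * η * L (W t) + 2 * η * ε := by
    intro t ht
    have e : R (t + 1) = R t + 2 * η * ∑ i, ∑ j, gradM L (W t) i j * (Wε - W t) i j
        + η ^ 2 * ∑ i, ∑ j, gradM L (W t) i j ^ 2 := by
      simp only [R, hWrec t ht, Finset.mul_sum, ← Finset.sum_add_distrib]
      refine Finset.sum_congr rfl fun i _ => Finset.sum_congr rfl fun j _ => ?_
      simp
      ring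
    have h1 := hc (W t) (Wε - W t)
    rw [add_sub_cancel, fderiv_eq_gradM] at h1
    have h2 := self (W t)
    have h3 : η ^ 2 * ∑ i, ∑ j, gradM L (W t) i j ^ 2 ≤ 2 / 3 * η * L (W t) := by
      calc _ ≤ η ^ 2 * (2 * M * L (W t)) := by gcongr
        _ = 2 * (η * L (W t)) * (η * M) := by ring
        _ ≤ 2 * (η * L (W t)) * (1 / 3) := by
          have := mul_nonneg hη0.le (h0 (W t))
          gcongr
        _ = _ := by ring
    have h4 : 2 * η * ∑ i, ∑ j, gradM L (W t) i j * (Wε - W t) i j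
        ≤ 2 * η * (ε - L (W t)) := by
      gcongr
      linarith
    rw [e]
    linarith
  have hF : frob Wε ^ 2 = R 1 := by
    unfold frob
    rw [Real.sq_sqrt (Finset.sum_nonneg fun _ _ => Finset.sum_nonneg fun _ _ => sq_nonneg _)]
    simp [R, hW1]
  have main : ∀ T : ℕ, 1 ≤ T → R (T + 1) + 4 / 3 * η * T * L (W T) ≤ R 1 + 2 * η * T * ε := by
    intro T hT
    induction T, hT using Nat.le_induction with
    | base =>
      have := hR 1 le_rfl
      push_cast
      linarith
    | succ T hT ih =>
      have h1 := hR (T + 1) (by omega)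
      have h2 : 4 / 3 * η * T * L (W (T + 1)) ≤ 4 / 3 * η * T * L (W T) := by
        gcongr
        exact mono T hT
      push_cast
      linarith
  intro T hT
  have hTpos : (0 : ℝ) < T := by exact_mod_cast hT
  have h1 := main T hT
  have h2 := hR0 (T + 1)
  rw [hF, ← sub_le_iff_le_add, le_div_iff₀ (by positivity)]
  have h3 : 0 ≤ η * T * L (W T) := mul_nonneg (by positivity) (h0 _)
  linarith

/-- optimization error bound for gradient descent on the empirical risk of a
multiclass loss with nonnegative, convex template that is `β`-smooth w.r.t. the `L_p` norm
(`p ∈ [2,∞]`), with step size `η ≤ 1/(6 β k^{2/p})`: for any `W*_ε` with `L̂(W*_ε) ≤ ε` and any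
`T ≥ 1`, `L̂(W_T) ≤ ‖W*_ε‖_F²/(ηT) + 2ε`. -/
theorem statement6 {k d n : ℕ} (hk : 2 ≤ k) (hn : 1 ≤ n)
    (p q : ℝ≥0∞) (hp : 2 ≤ p) (hpq : 1 / p + 1 / q = 1)
    (β : ℝ) (ltil : (Fin (k - 1) → ℝ) → ℝ)
    (hnonneg : ∀ u, 0 ≤ ltil u)
    (hconv : ConvexOn ℝ Set.univ ltil)
    (hdiff : Differentiable ℝ ltil)
    (hsmooth : ∀ u v, pnorm q (grad ltil u - grad ltil v) ≤ β * pnorm p (u - v))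
    (x : Fin n → Fin d → ℝ) (y : Fin n → Fin k) (hx : ∀ i, pnorm 2 (x i) ≤ 1)
    (Lhat : (Fin k → Fin d → ℝ) → ℝ)
    (hLhat : Lhat = fun W => (1 / n : ℝ) * ∑ i, ltil (Dmap (y i) (fun r => ∑ t, W r t * x i t)))
    (η : ℝ) (hη0 : 0 < η) (hη : η ≤ 1 / (6 * β * (k : ℝ) ^ (2 / p.toReal)))
    (W : ℕ → Fin k → Fin d → ℝ) (hW1 : W 1 = 0)
    (hWrec : ∀ t, 1 ≤ t → W (t + 1) = W t - η • gradM Lhat (W t))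
    (ε : ℝ) (hε : 0 < ε) (Wε : Fin k → Fin d → ℝ) (hWε : Lhat Wε ≤ ε) :
    ∀ T : ℕ, 1 ≤ T → Lhat (W T) ≤ frob Wε ^ 2 / (η * T) + 2 * ε := by
  have hkpos : (0 : ℝ) < k := by
    have : 0 < k := by omega
    exact_mod_cast this
  set K : ℝ := (k : ℝ) ^ (2 / p.toReal) with hK
  have hKpos : 0 < K := Real.rpow_pos_of_pos hkpos _
  have hβ : 0 < β := by
    have h1 : 0 < 1 / (6 * β * K) := lt_of_lt_of_le hη0 hη
    have h2 : 0 < 6 * β * K := one_div_pos.1 h1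
    have h3 : 0 < 6 * β := pos_of_mul_pos_left h2 hKpos.le
    linarith
  have hnpos : (0 : ℝ) < n := by exact_mod_cast hn
  have hL : Lhat = fun W => (1 / n : ℝ) * ∑ i, ltil (Amap (y i) (x i) W) := hLhat
  have hLd : ∀ U, HasFDerivAt Lhat
      ((1 / n : ℝ) • ∑ i, (fderiv ℝ ltil (Amap (y i) (x i) U)).comp (Amap (y i) (x i))) U := by
    intro U
    rw [hL]
    refine HasFDerivAt.const_mul ?_ _
    refine HasFDerivAt.fun_sum fun i _ => ?_
    exact (hdiff (Amap (y i) (x i) U)).hasFDerivAt.comp U (Amap (y i) (x i)).hasFDerivAt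
  have hLf : ∀ U V, fderiv ℝ Lhat U V
      = (1 / n : ℝ) * ∑ i, fderiv ℝ ltil (Amap (y i) (x i) U) (Amap (y i) (x i) V) := by
    intro U V
    rw [(hLd U).fderiv]
    simp
  have hA : ∀ i V, pnorm p (Amap (y i) (x i) V) ^ 2 ≤ K * (2 * ∑ a, ∑ b, V a b ^ 2) := by
    intro i V
    apply pnorm_sq_le hp hk
    · exact mul_nonneg (by norm_num)
        (Finset.sum_nonneg fun _ _ => Finset.sum_nonneg fun _ _ => sq_nonneg _)
    · intro j
      refine (Dmap_sq_le (y i) (fun r => ∑ t, V r t * x i t) j).trans ?_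
      have := matvec_sq_le V (x i) (hx i)
      linarith
  refine gd_abstract Lhat (2 * β * K) (by positivity) ?_ ?_ ?_ η hη0 ?_ W hW1 hWrec ε hε Wε hWε
  · intro U
    rw [hL]
    exact mul_nonneg (by positivity) (Finset.sum_nonneg fun i _ => hnonneg _)
  · intro U V
    rw [hLf, hL]
    simp only [← mul_add, ← Finset.sum_add_distrib, map_add]
    refine mul_le_mul_of_nonneg_left (Finset.sum_le_sum fun i _ => ?_) (by positivity)
    exact convex_first_order hdiff hconv _ _
  · intro U V
    rw [hLf, hL]
    have e : 2 * β * K / 2 * ∑ a, ∑ b, V a b ^ 2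
        = (1 / n : ℝ) * ∑ i : Fin n, (β / 2 * (K * (2 * ∑ a, ∑ b, V a b ^ 2))) := by
      rw [Finset.sum_const, Finset.card_univ, Fintype.card_fin, nsmul_eq_mul]
      field_simp
    rw [e]
    simp only [← mul_add, ← Finset.sum_add_distrib, map_add]
    refine mul_le_mul_of_nonneg_left (Finset.sum_le_sum fun i _ => ?_) (by positivity)
    refine (descent_ltil hp hpq hdiff hsmooth _ _).trans ?_
    gcongr
    exact hA i V
  · rw [le_div_iff₀ (by positivity)] at hη
    linarith
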